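/- Let 0 ≤ a < 1 < b ≤ ∞, let f ∈ F₁(a,b) be strictly convex on a neighborhood of 1, and set z₀ := f'_+(1). Assume z₀ lies in the interior of the set {f* < ∞}. Let P be a probability measure on X and h : X → ℝ bounded measurable with α ≤ h ≤ β. Then the infimum defining Λ_f^P[h] can be restricted to a compact interval: Λ_f^P[h] = inf_{ν ∈ [α−z₀, β−z₀]} { ν + E_P[f*(h−ν)] }. -/

import Mathlib

open MeasureTheory Set Filter Topology
open scoped ENNReal NNReal Classical

noncomputable section

/-- The interval `(a, b)` with `b` possibly infinite. -/
def Dom (a : ℝ) (b : EReal) : Set ℝ := {t : ℝ | a < t ∧ (t : EReal) < b}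

/-- Legendre transform of `f` on `(a,b)`, with values in `(-∞, ∞]` (modeled by `EReal`). -/
def fStar (f : ℝ → ℝ) (a : ℝ) (b : EReal) (z : ℝ) : EReal :=
  ⨆ t ∈ Dom a b, ((z * t - f t : ℝ) : EReal)

/-- Real-valued version of the Legendre transform (junk value where it is `⊤`). -/
def fStarR (f : ℝ → ℝ) (a : ℝ) (b : EReal) (z : ℝ) : ℝ := (fStar f a b z).toReal

/-- Right derivative of `g` at `z`. -/
def rderiv (g : ℝ → ℝ) (z : ℝ) : ℝ := derivWithin g (Ici z) z

/-- `z₀ := f'_+(1)`. -/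
def zz (f : ℝ → ℝ) : ℝ := rderiv f 1

/-- Integral of an `EReal`-valued function: the Bochner integral if the function is
a.e. finite and integrable, and `⊤` otherwise. -/
def eIntegral {X : Type*} [MeasurableSpace X] (P : Measure X) (g : X → EReal) : EReal :=
  if (∀ᵐ x ∂P, g x ≠ ⊤) ∧ Integrable (fun x => (g x).toReal) P
  then ((∫ x, (g x).toReal ∂P : ℝ) : EReal) else ⊤

/-- The generalized cumulant generating function `Λ_f^P[h]`. -/
def cgf {X : Type*} [MeasurableSpace X] (f : ℝ → ℝ) (a : ℝ) (b : EReal)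
    (P : Measure X) (h : X → ℝ) : EReal :=
  ⨅ ν : ℝ, ((ν : EReal) + eIntegral P (fun x => fStar f a b (h x - ν)))

/-- Real-valued `Λ_f^P[h]`. -/
def cgfR {X : Type*} [MeasurableSpace X] (f : ℝ → ℝ) (a : ℝ) (b : EReal)
    (P : Measure X) (h : X → ℝ) : ℝ := (cgf f a b P h).toReal

/-- `Λ_f : ℝⁿ → ℝ` (with values in `EReal`). -/
def lamVec (f : ℝ → ℝ) (a : ℝ) (b : EReal) {n : ℕ} (x : Fin n → ℝ) : EReal :=
  ⨅ ν : ℝ, ((ν : EReal) + ((n : ℝ)⁻¹ : EReal) * ∑ i, fStar f a b (x i - ν))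

/-- Empirical measure of `n` points. -/
def empMeas {X : Type*} [MeasurableSpace X] (n : ℕ) (xs : Fin n → X) : Measure X :=
  (n : ℝ≥0∞)⁻¹ • ∑ i, Measure.dirac (xs i)

/-- The `(f,Γ)`-divergence `D_f^Γ(Q‖P)`. -/
def Dfg {X : Type*} [MeasurableSpace X] (f : ℝ → ℝ) (a : ℝ) (b : EReal)
    (Γ : Set (X → ℝ)) (Q P : Measure X) : ℝ :=
  sSup {r : ℝ | ∃ h ∈ Γ, r = ∫ x, h x ∂Q - cgfR f a b P h}

/-- Empirical Rademacher complexity of `Ψ` at the sample `y`. -/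
def empRad {Y : Type*} (Ψ : Set (Y → ℝ)) (n : ℕ) (y : Fin n → Y) : ℝ :=
  (2 ^ n : ℝ)⁻¹ * ∑ σ : Fin n → Bool,
    sSup {r : ℝ | ∃ ψ ∈ Ψ, r = (n : ℝ)⁻¹ * ∑ i, (if σ i then 1 else -1) * ψ (y i)}

/-- Rademacher complexity of `Ψ` relative to `P` with `n` samples. -/
def rad {Y : Type*} [MeasurableSpace Y] (Ψ : Set (Y → ℝ)) (P : Measure Y) (n : ℕ) : ℝ :=
  ∫ y, empRad Ψ n y ∂(Measure.pi fun _ : Fin n => P)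

/-- `Δ_{f,n}`. -/
def Δq (f : ℝ → ℝ) (a : ℝ) (b : EReal) (α β : ℝ) (n : ℕ) : ℝ :=
  sInf ((fun z => (n : ℝ) * (-z + (((n : ℝ) - 1) / (n : ℝ)) * fStarR f a b z
      + (1 / (n : ℝ)) * fStarR f a b (β - α + z))) '' Icc (zz f - (β - α)) (zz f))

/-- `sup_{h ∈ Γ} inf_{h̃ ∈ Γ̃} ‖h − h̃‖_∞`. -/
def approxErr {X : Type*} (Γ Γt : Set (X → ℝ)) : ℝ :=
  sSup {r : ℝ | ∃ h ∈ Γ, r = sInf {s : ℝ | ∃ ht ∈ Γt, s = ⨆ x, |h x - ht x|}}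

/-- A countable subset which is pointwise-limit dense. -/
def PtwiseDenseCount {X : Type*} (Γ : Set (X → ℝ)) : Prop :=
  ∃ Γ₀ ⊆ Γ, Γ₀.Countable ∧ ∀ h ∈ Γ, ∃ s : ℕ → X → ℝ,
    (∀ j, s j ∈ Γ₀) ∧ ∀ x, Tendsto (fun j => s j x) atTop (𝓝 (h x))

/-- The quantity `K_{f,Ψ,P,n}` from Definition 3.4: either `(f*)'_+` is Lipschitz on the
relevant interval and `Ψ` contains a constant, in which case `K` is the minimum of the two
expressions, or `K` is the second expression. -/
def Kchoice (f : ℝ → ℝ) (a : ℝ) (b : EReal) (α β : ℝ) {Y : Type*} [MeasurableSpace Y]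
    (Ψ : Set (Y → ℝ)) (P : Measure Y) (n : ℕ) (K : ℝ) : Prop :=
  (∃ L : ℝ≥0, LipschitzOnWith L (rderiv (fStarR f a b))
      (Icc (zz f - (β - α)) (zz f + (β - α))) ∧
    (∃ c : ℝ, (fun _ => c) ∈ Ψ) ∧
    K = min ((1 + 2 * (β - α) * (L : ℝ)) * rad Ψ P n
        + (β - α) ^ 2 * (L : ℝ) / (2 * Real.sqrt n))
      (rderiv (fStarR f a b) (β - α + zz f) * (rad Ψ P n + (β - α) / (2 * Real.sqrt n))))
  ∨ K = rderiv (fStarR f a b) (β - α + zz f) * (rad Ψ P n + (β - α) / (2 * Real.sqrt n))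

/-- Covering number of a (pseudo)metric space by `ε`-balls. -/
def coverNum (Θ : Type*) [PseudoMetricSpace Θ] (ε : ℝ) : ℝ≥0∞ :=
  ⨅ s ∈ {s : Finset Θ | ∀ θ : Θ, ∃ c ∈ s, dist θ c ≤ ε}, ((s.card : ℝ≥0∞))

end

/-- The right derivative at an interior point of a convex set is a subgradient. -/
lemma ConvexOn.rderiv_mul_sub_le {S : Set ℝ} {f : ℝ → ℝ} {x t : ℝ} (hf : ConvexOn ℝ S f)
    (hx : x ∈ interior S) (ht : t ∈ S) : rderiv f x * (t - x) ≤ f t - f x := by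
  rw [rderiv, ← derivWithin_Ioi_eq_Ici]
  rcases lt_trichotomy x t with hxt | rfl | htx
  · have hslope := hf.rightDeriv_le_slope_of_mem_interior hx ht hxt
    rwa [slope_def_field, le_div_iff₀ (sub_pos.2 hxt)] at hslope
  · simp
  · have hslope := (hf.slope_le_leftDeriv_of_mem_interior ht hx htx).trans
      (hf.leftDeriv_le_rightDeriv_of_mem_interior hx)
    rw [slope_def_field, div_le_iff₀ (sub_pos.2 htx)] at hslope
    linarith

lemma isOpen_Dom (a : ℝ) (b : EReal) : IsOpen (Dom a b) :=
  (isOpen_lt continuous_const continuous_id).inter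
    (isOpen_lt continuous_coe_real_ereal continuous_const)

lemma le_fStar {f : ℝ → ℝ} {a : ℝ} {b : EReal} {t : ℝ} (ht : t ∈ Dom a b) (z : ℝ) :
    ((z * t - f t : ℝ) : EReal) ≤ fStar f a b z :=
  le_iSup₂ (f := fun t (_ : t ∈ Dom a b) => ((z * t - f t : ℝ) : EReal)) t ht

lemma monotone_fStar (f : ℝ → ℝ) {a : ℝ} (b : EReal) (ha : 0 ≤ a) : Monotone (fStar f a b) := by
  intro y z hyz
  refine iSup₂_le fun t ht => le_trans ?_ (le_fStar ht z)
  have := mul_le_mul_of_nonneg_right hyz (ha.trans ht.1.le)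
  exact_mod_cast sub_le_sub_right this (f t)

/-- Moving away from the subgradient `z` of `f` at `1`, the Legendre transform has slope at
least `1` to the right of `z` and at most `1` to the left of `z`. -/
lemma fStar_le_fStar_add {f : ℝ → ℝ} {a : ℝ} {b : EReal} {y z s : ℝ} (h1 : 1 ∈ Dom a b)
    (hf1 : f 1 = 0) (hz : ∀ t ∈ Dom a b, z * (t - 1) ≤ f t)
    (hs : (s ≤ 0 ∧ y ≤ z) ∨ (0 ≤ s ∧ z ≤ y)) :
    fStar f a b y ≤ fStar f a b (y + s) + ((-s : ℝ) : EReal) := by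
  refine iSup₂_le fun t ht => ?_
  have hbound : ((y * t - f t + s : ℝ) : EReal) ≤ fStar f a b (y + s) := by
    by_cases hst : 0 ≤ s * (t - 1)
    · refine le_trans ?_ (le_fStar ht _)
      exact_mod_cast (by linarith : y * t - f t + s ≤ (y + s) * t - f t)
    · refine le_trans ?_ (le_fStar h1 _)
      have hyz : (y - z) * (t - 1) ≤ 0 := by
        rcases hs with ⟨hs, hy⟩ | ⟨hs, hy⟩
        · have : 0 ≤ t - 1 := by
            by_contra! hlt
            exact hst (mul_nonneg_of_nonpos_of_nonpos hs hlt.le)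
          exact mul_nonpos_of_nonpos_of_nonneg (by linarith) this
        · have : t - 1 ≤ 0 := by
            by_contra! hlt
            exact hst (mul_nonneg hs hlt.le)
          exact mul_nonpos_of_nonneg_of_nonpos (by linarith) this
      have := hz t ht
      rw [hf1]
      exact_mod_cast (by linarith : y * t - f t + s ≤ (y + s) * 1 - 0)
  calc ((y * t - f t : ℝ) : EReal)
      = ((y * t - f t + s : ℝ) : EReal) + ((-s : ℝ) : EReal) := by
        rw [← EReal.coe_add]; congr 1; ring
    _ ≤ _ := by gcongr

lemma eIntegral_le_add {X : Type*} [MeasurableSpace X] {P : Measure X} [IsProbabilityMeasure P]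
    {g₁ g₂ : X → EReal} {c r : ℝ} (hmeas : Measurable g₁) (hc : ∀ x, (c : EReal) ≤ g₁ x)
    (hle : ∀ x, g₁ x ≤ g₂ x + (r : EReal)) :
    eIntegral P g₁ ≤ eIntegral P g₂ + (r : EReal) := by
  by_cases h₂ : (∀ᵐ x ∂P, g₂ x ≠ ⊤) ∧ Integrable (fun x => (g₂ x).toReal) P
  · obtain ⟨hfin, hint⟩ := h₂
    have hbot x : g₁ x ≠ ⊥ := ((EReal.bot_lt_coe c).trans_le (hc x)).ne'
    have hreal : ∀ᵐ x ∂P, g₁ x ≠ ⊤ ∧ c ≤ (g₁ x).toReal ∧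
        (g₁ x).toReal ≤ (g₂ x).toReal + r := by
      filter_upwards [hfin] with x hx
      have hlex := hle x
      have hcx := hc x
      have hbx := hbot x
      generalize g₁ x = u at *
      generalize g₂ x = v at *
      induction v with
      | top => exact absurd rfl hx
      | bot => simp_all
      | coe v =>
        rw [← EReal.coe_add] at hlex
        induction u with
        | top => exact absurd (top_le_iff.1 hlex) (EReal.coe_ne_top _)
        | bot => simp at hbx
        | coe u =>
          exact ⟨EReal.coe_ne_top u, EReal.coe_le_coe_iff.1 hcx, EReal.coe_le_coe_iff.1 hlex⟩
    have hint₁ : Integrable (fun x => (g₁ x).toReal) P :=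
      integrable_of_le_of_le hmeas.ereal_toReal.aestronglyMeasurable
        (hreal.mono fun _ hx => hx.2.1) (hreal.mono fun _ hx => hx.2.2)
        (integrable_const c) (hint.add (integrable_const r))
    rw [eIntegral, eIntegral, if_pos ⟨hreal.mono fun _ hx => hx.1, hint₁⟩, if_pos ⟨hfin, hint⟩,
      ← EReal.coe_add, EReal.coe_le_coe_iff]
    calc ∫ x, (g₁ x).toReal ∂P ≤ ∫ x, ((g₂ x).toReal + r) ∂P :=
          integral_mono_ae hint₁ (hint.add (integrable_const r)) (hreal.mono fun _ hx => hx.2.2)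
      _ = ∫ x, (g₂ x).toReal ∂P + r := by
          rw [integral_add hint (integrable_const r)]; simp
  · simp [eIntegral, if_neg h₂]

/-- The objective `ν ↦ ν + E_P[f*(h - ν)]` does not decrease when `ν` moves from `μ` away from
the region where `h - μ` crosses the subgradient `z` of `f` at `1`. -/
lemma add_eIntegral_fStar_le {X : Type*} [MeasurableSpace X] {P : Measure X}
    [IsProbabilityMeasure P] {f : ℝ → ℝ} {a : ℝ} {b : EReal} {α z μ ν : ℝ} {h : X → ℝ}
    (ha : 0 ≤ a) (h1 : 1 ∈ Dom a b) (hf1 : f 1 = 0) (hz : ∀ t ∈ Dom a b, z * (t - 1) ≤ f t)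
    (hmeas : Measurable h) (hα : ∀ x, α ≤ h x)
    (hμν : (μ ≤ ν ∧ ∀ x, h x - μ ≤ z) ∨ (ν ≤ μ ∧ ∀ x, z ≤ h x - μ)) :
    (μ : EReal) + eIntegral P (fun x => fStar f a b (h x - μ)) ≤
      (ν : EReal) + eIntegral P (fun x => fStar f a b (h x - ν)) := by
  have hle : eIntegral P (fun x => fStar f a b (h x - μ)) ≤
      eIntegral P (fun x => fStar f a b (h x - ν)) + ((ν - μ : ℝ) : EReal) := by
    refine eIntegral_le_add (c := α - μ)
      ((monotone_fStar f b ha).measurable.comp (hmeas.sub_const μ)) (fun x => ?_) (fun x => ?_)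
    · refine le_trans ?_ (le_fStar h1 _)
      rw [hf1]
      exact_mod_cast (by linarith [hα x] : α - μ ≤ (h x - μ) * 1 - 0)
    · have := fStar_le_fStar_add (y := h x - μ) (s := μ - ν) h1 hf1 hz
        (hμν.imp (fun hh => ⟨sub_nonpos.2 hh.1, hh.2 x⟩) (fun hh => ⟨sub_nonneg.2 hh.1, hh.2 x⟩))
      simpa using this
  calc (μ : EReal) + eIntegral P (fun x => fStar f a b (h x - μ))
      ≤ μ + (eIntegral P (fun x => fStar f a b (h x - ν)) + ((ν - μ : ℝ) : EReal)) := by gcongr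
    _ = ν + eIntegral P (fun x => fStar f a b (h x - ν)) := by
        rw [add_left_comm, ← EReal.coe_add, add_sub_cancel, add_comm]

/-- The infimum defining `Λ_f^P[h]` can be restricted to
the compact interval `[α − z₀, β − z₀]`. -/
theorem stmt1 {X : Type*} [MeasurableSpace X]
    (f : ℝ → ℝ) (a : ℝ) (b : EReal) (α β : ℝ)
    (ha0 : 0 ≤ a) (ha1 : a < 1) (hb1 : ((1 : ℝ) : EReal) < b)
    (hconv : ConvexOn ℝ (Dom a b) f) (hf1 : f 1 = 0)
    (hstrict : ∃ ε > 0, Set.Ioo (1 - ε) (1 + ε) ⊆ Dom a b ∧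
      StrictConvexOn ℝ (Set.Ioo (1 - ε) (1 + ε)) f)
    (hz0 : zz f ∈ interior {z : ℝ | fStar f a b z < ⊤})
    (P : MeasureTheory.Measure X) [MeasureTheory.IsProbabilityMeasure P]
    (h : X → ℝ) (hmeas : Measurable h) (hαβ : α ≤ β) (hbd : ∀ x, h x ∈ Set.Icc α β) :
    cgf f a b P h = ⨅ ν ∈ Set.Icc (α - zz f) (β - zz f),
      ((ν : EReal) + eIntegral P (fun x => fStar f a b (h x - ν))) := by
  have h1 : (1 : ℝ) ∈ Dom a b := ⟨ha1, hb1⟩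
  have hsub : ∀ t ∈ Dom a b, zz f * (t - 1) ≤ f t := fun t ht => by
    have hslope := hconv.rderiv_mul_sub_le (x := 1) ((isOpen_Dom a b).interior_eq.symm ▸ h1) ht
    rwa [hf1, sub_zero] at hslope
  refine le_antisymm (le_iInf₂ fun ν _ => iInf_le _ ν) (le_iInf fun ν => ?_)
  rcases lt_or_ge ν (α - zz f) with hν | hαν
  · exact (iInf₂_le (α - zz f) ⟨le_rfl, by linarith⟩).trans
      (add_eIntegral_fStar_le ha0 h1 hf1 hsub hmeas (fun x => (hbd x).1)
        (Or.inr ⟨hν.le, fun x => by linarith [(hbd x).1]⟩))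
  rcases lt_or_ge (β - zz f) ν with hν | hνβ
  · exact (iInf₂_le (β - zz f) ⟨by linarith, le_rfl⟩).trans
      (add_eIntegral_fStar_le ha0 h1 hf1 hsub hmeas (fun x => (hbd x).1)
        (Or.inl ⟨hν.le, fun x => by linarith [(hbd x).2]⟩))
  · exact iInf₂_le ν ⟨hαν, hνβ⟩
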